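/- arXiv:1609.00317 — 3 statements merged into one kernel-verified Lean document; each statement's English description precedes it below -/
import Mathlib

section
/- Let γ̄ > 0, κ > 0 and let μ, m be positive integers with m ≥ μ. Set Δ₂ = ((μκ+m)/m)·γ̄/(μ(1+κ)). Then for every x ≥ 0, the κ-μ shadowed CDF satisfies ∫₀ˣ f_S(t) dt = 1 − Σ_{j=0}^{m−μ} B_j e^{−x/Δ₂} Σ_{r=0}^{m−j−1} (1/r!)(x/Δ₂)^r, where B_j = C(m−μ, j) · (m/(μκ+m))^j · (μκ/(μκ+m))^{m−μ−j}. -/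
open Real MeasureTheory Finset

/-- Rising factorial (Pochhammer symbol) `(a)ₙ = a(a+1)⋯(a+n−1)`. -/
noncomputable def risingFactorial (a : ℝ) (n : ℕ) : ℝ := ∏ i ∈ Finset.range n, (a + i)

/-- Confluent hypergeometric function `₁F₁(a; b; z) = Σ (a)ₙ/(b)ₙ zⁿ/n!`. -/
noncomputable def hyp1F1 (a b z : ℝ) : ℝ :=
  ∑' n : ℕ, risingFactorial a n / risingFactorial b n * z ^ n / (Nat.factorial n : ℝ)

/-- The κ-μ shadowed density with integer fading parameters μ, m. -/
noncomputable def kmuShadowedPDF (γ κ : ℝ) (μ m : ℕ) (x : ℝ) : ℝ :=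
  ((μ : ℝ) ^ μ * (m : ℝ) ^ m * (1 + κ) ^ μ) /
      ((Nat.factorial (μ - 1) : ℝ) * ((m : ℝ) + μ * κ) ^ m * γ) *
    (x / γ) ^ (μ - 1) * Real.exp (-(μ * (1 + κ) * x / γ)) *
    hyp1F1 m μ ((μ : ℝ) ^ 2 * κ * (1 + κ) * x / (((μ : ℝ) * κ + m) * γ))

theorem risingFactorial_succ_eq (s n : ℕ) :
    risingFactorial ((s + 1 : ℕ) : ℝ) n = ((s + n).factorial : ℝ) / (s.factorial : ℝ) := by
  have hs : (s.factorial : ℝ) ≠ 0 := by positivity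
  induction n with
  | zero => simp [risingFactorial, hs]
  | succ n ih =>
    have h : risingFactorial ((s + 1 : ℕ) : ℝ) (n + 1) =
        risingFactorial ((s + 1 : ℕ) : ℝ) n * (((s + 1 : ℕ) : ℝ) + n) :=
      Finset.prod_range_succ _ _
    rw [h, ih, ← Nat.add_assoc, Nat.factorial_succ]
    push_cast
    ring

/-- The Vandermonde convolution, in the form needed for the Cauchy product of power series. -/
theorem risingFactorial_div_factorial_eq_sum (s N n : ℕ) :
    risingFactorial ((s + 1 + N : ℕ) : ℝ) n / risingFactorial ((s + 1 : ℕ) : ℝ) n /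
        (n.factorial : ℝ) =
      ∑ kl ∈ antidiagonal n, ((N.choose kl.1 : ℝ) * s.factorial / (s + kl.1).factorial) *
        (1 / (kl.2.factorial : ℝ)) := by
  have h1 : (s + 1 + N : ℕ) = (s + N) + 1 := by omega
  rw [h1, risingFactorial_succ_eq, risingFactorial_succ_eq]
  have hV : ((N + (s + n)).choose n : ℝ) =
      ∑ kl ∈ antidiagonal n, (N.choose kl.1 : ℝ) * ((s + n).choose kl.2 : ℝ) := by
    rw [Nat.add_choose_eq]
    push_cast
    rfl
  have hc : ((N + (s + n)).choose n : ℝ) =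
      (s + N + n).factorial / (n.factorial * (s + N).factorial) := by
    rw [Nat.cast_choose ℝ (by omega : n ≤ N + (s + n)), (by omega : N + (s + n) - n = s + N),
      (by omega : N + (s + n) = s + N + n)]
  have hs : (s.factorial : ℝ) ≠ 0 := by positivity
  have hsn : ((s + n).factorial : ℝ) ≠ 0 := by positivity
  calc _ = (s.factorial : ℝ) / (s + n).factorial * ((N + (s + n)).choose n : ℝ) := by
        rw [hc]
        field_simp
    _ = _ := by
        rw [hV, Finset.mul_sum]
        refine Finset.sum_congr rfl fun kl hkl => ?_
        obtain ⟨k, l⟩ := kl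
        have hkl' : k + l = n := by simpa using hkl
        subst hkl'
        have h2 : s + (k + l) - l = s + k := by omega
        rw [Nat.cast_choose ℝ (by omega : l ≤ s + (k + l)), h2]
        field_simp

/-- Kummer's transformation for positive integer parameters `s + 1 + N` and `s + 1`. -/
theorem hyp1F1_add_nat (s N : ℕ) (z : ℝ) :
    hyp1F1 ((s + 1 + N : ℕ) : ℝ) ((s + 1 : ℕ) : ℝ) z =
      (∑ k ∈ range (N + 1), (N.choose k : ℝ) * s.factorial / (s + k).factorial * z ^ k) *
        Real.exp z := by
  set a : ℕ → ℝ := fun k => (N.choose k : ℝ) * s.factorial / (s + k).factorial * z ^ k with ha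
  have ha0 : ∀ k ∉ range (N + 1), a k = 0 := by
    intro k hk
    have : N < k := by simpa using hk
    simp [ha, Nat.choose_eq_zero_of_lt this]
  have hb : Summable fun n : ℕ => ‖z ^ n / (n.factorial : ℝ)‖ :=
    (Real.summable_pow_div_factorial z).norm
  have hsa : Summable fun n => ‖a n‖ :=
    summable_of_ne_finset_zero (s := range (N + 1)) fun k hk => by simp [ha0 k hk]
  rw [Real.exp_eq_exp_ℝ, NormedSpace.exp_eq_tsum_div, ← tsum_eq_sum (L := .unconditional ℕ) ha0,
    tsum_mul_tsum_eq_tsum_sum_antidiagonal_of_summable_norm hsa hb, hyp1F1]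
  refine tsum_congr fun n => ?_
  rw [mul_div_right_comm, risingFactorial_div_factorial_eq_sum, Finset.sum_mul]
  refine Finset.sum_congr rfl fun kl hkl => ?_
  rw [← mem_antidiagonal.mp hkl, pow_add]
  simp only [ha]
  ring

theorem hasDerivAt_exp_neg_mul_sum_pow_div_factorial (n : ℕ) (y : ℝ) :
    HasDerivAt (fun y : ℝ => Real.exp (-y) * ∑ r ∈ range (n + 1), 1 / (r.factorial : ℝ) * y ^ r)
      (-(Real.exp (-y) * (y ^ n / n.factorial))) y := by
  have he : HasDerivAt (fun y : ℝ => Real.exp (-y)) (-Real.exp (-y)) y := by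
    simpa using (hasDerivAt_neg y).exp
  induction n with
  | zero => simpa using he
  | succ n ih =>
    have hp : HasDerivAt (fun y : ℝ => 1 / ((n + 1).factorial : ℝ) * y ^ (n + 1))
        (y ^ n / n.factorial) y := by
      refine ((hasDerivAt_pow (n + 1) y).const_mul _).congr_deriv ?_
      rw [Nat.factorial_succ]
      push_cast
      field_simp
    have h := ih.add (he.mul hp)
    refine (h.congr_deriv ?_).congr_of_eventuallyEq (Filter.Eventually.of_forall fun w => ?_)
    · ring
    · simp only [Finset.sum_range_succ _ (n + 1), Pi.add_apply, Pi.mul_apply]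
      ring

/-- For `m ≥ μ` the shadowed density is a binomial mixture of Erlang densities. -/
theorem kmuShadowedPDF_eq_sum (γ κ : ℝ) (hγ : 0 < γ) (hκ : 0 < κ) (s N : ℕ) (Δ p q : ℝ)
    (hp : p = ((s + 1 + N : ℕ) : ℝ) / ((s + 1 : ℕ) * κ + (s + 1 + N : ℕ)))
    (hq : q = ((s + 1 : ℕ) : ℝ) * κ / ((s + 1 : ℕ) * κ + (s + 1 + N : ℕ)))
    (hΔ : Δ = (((s + 1 : ℕ) * κ + (s + 1 + N : ℕ)) / (s + 1 + N : ℕ)) *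
      (γ / ((s + 1 : ℕ) * (1 + κ)))) (t : ℝ) :
    kmuShadowedPDF γ κ (s + 1) (s + 1 + N) t =
      ∑ k ∈ range (N + 1), (N.choose k : ℝ) * p ^ (N - k) * q ^ k *
        (Real.exp (-(t / Δ)) * ((t / Δ) ^ (s + k) / (s + k).factorial)) / Δ := by
  rw [kmuShadowedPDF, hyp1F1_add_nat]
  set u : ℝ := ((s + 1 : ℕ) : ℝ) with hu
  set M : ℝ := ((s + 1 + N : ℕ) : ℝ) with hM
  have hu0 : 0 < u := by positivity
  have hM0 : 0 < M := by positivity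
  have hp0 : 0 < p := by rw [hp]; positivity
  have hΔ0 : 0 < Δ := by rw [hΔ]; positivity
  have hz : u ^ 2 * κ * (1 + κ) * t / ((u * κ + M) * γ) = q / p * (t / Δ) := by
    rw [hq, hp, hΔ]
    field_simp
  have hexp : -(u * (1 + κ) * t / γ) + q / p * (t / Δ) = -(t / Δ) := by
    rw [hq, hp, hΔ]
    field_simp
    ring
  have hβ : u * (1 + κ) / γ = 1 / (p * Δ) := by
    rw [hp, hΔ]
    field_simp
  have hconst : u ^ (s + 1) * M ^ (s + 1 + N) * (1 + κ) ^ (s + 1) /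
      ((Nat.factorial (s + 1 - 1) : ℝ) * (M + u * κ) ^ (s + 1 + N) * γ) * (t / γ) ^ (s + 1 - 1) =
      p ^ N / s.factorial * (t / Δ) ^ s / Δ := by
    calc _ = (u * (1 + κ) / γ) ^ (s + 1) * p ^ (s + 1 + N) * t ^ s / s.factorial := by
          rw [hp, add_tsub_cancel_right, add_comm (u * κ) M]
          simp only [div_pow, mul_pow]
          field_simp
          ring
      _ = _ := by
          rw [hβ]
          simp only [div_pow, mul_pow, pow_add, one_pow]
          field_simp
  rw [hconst, hz, mul_comm (Finset.sum _ _), mul_assoc, ← mul_assoc (Real.exp _), ← Real.exp_add,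
    hexp, Finset.mul_sum, Finset.mul_sum]
  refine Finset.sum_congr rfl fun k hk => ?_
  have hkN : k ≤ N := by
    have := Finset.mem_range.mp hk
    omega
  obtain ⟨l, rfl⟩ := Nat.exists_eq_add_of_le hkN
  rw [Nat.add_sub_cancel_left]
  simp only [mul_pow, div_pow, pow_add]
  field_simp

theorem kmuShadowed_cdf_of_ge (γ κ : ℝ) (hγ : 0 < γ) (hκ : 0 < κ)
    (μ m : ℕ) (hμ : 0 < μ) (hm : 0 < m) (hmμ : μ ≤ m) (Δ₂ : ℝ)
    (hΔ₂ : Δ₂ = ((μ * κ + m) / m) * (γ / (μ * (1 + κ))))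
    (B : ℕ → ℝ)
    (hB : ∀ j, B j = (Nat.choose (m - μ) j : ℝ) * ((m : ℝ) / (μ * κ + m)) ^ j *
      ((μ : ℝ) * κ / (μ * κ + m)) ^ (m - μ - j))
    (x : ℝ) (hx : 0 ≤ x) :
    ∫ t in (0 : ℝ)..x, kmuShadowedPDF γ κ μ m t =
      1 - ∑ j ∈ Finset.range (m - μ + 1),
            B j * Real.exp (-x / Δ₂) *
              ∑ r ∈ Finset.range (m - j), (1 / (Nat.factorial r : ℝ)) * (x / Δ₂) ^ r := by
  obtain ⟨s, rfl⟩ : ∃ s, μ = s + 1 := ⟨μ - 1, by omega⟩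
  obtain ⟨N, rfl⟩ := Nat.exists_eq_add_of_le hmμ
  have hu0 : (0 : ℝ) < ((s + 1 : ℕ) : ℝ) := by positivity
  have hM0 : (0 : ℝ) < ((s + 1 + N : ℕ) : ℝ) := by positivity
  have hsub : s + 1 + N - (s + 1) = N := by omega
  rw [hsub]
  simp only [hsub] at hB
  set p : ℝ := ((s + 1 + N : ℕ) : ℝ) / ((s + 1 : ℕ) * κ + (s + 1 + N : ℕ)) with hp
  set q : ℝ := ((s + 1 : ℕ) : ℝ) * κ / ((s + 1 : ℕ) * κ + (s + 1 + N : ℕ)) with hq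
  have hpq : p + q = 1 := by
    rw [hp, hq]
    field_simp
    ring
  have hsumB : ∑ j ∈ range (N + 1), B j = 1 := by
    have h : (p + q) ^ N = 1 := by rw [hpq, one_pow]
    rw [← h, add_pow]
    refine Finset.sum_congr rfl fun j _ => ?_
    rw [hB]
    ring
  have hpdf : ∀ t, kmuShadowedPDF γ κ (s + 1) (s + 1 + N) t = ∑ j ∈ range (N + 1),
      B j * (Real.exp (-(t / Δ₂)) * ((t / Δ₂) ^ (s + N - j) / (s + N - j).factorial)) / Δ₂ := by
    intro t
    rw [kmuShadowedPDF_eq_sum γ κ hγ hκ s N Δ₂ p q hp hq hΔ₂, ← Finset.sum_flip]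
    refine Finset.sum_congr rfl fun j hj => ?_
    have hjN : j ≤ N := by
      have := Finset.mem_range.mp hj
      omega
    rw [hB, Nat.choose_symm hjN, Nat.sub_sub_self hjN, ← Nat.add_sub_assoc hjN]
  have hderiv : ∀ t, HasDerivAt (fun t => -∑ j ∈ range (N + 1), B j * (Real.exp (-(t / Δ₂)) *
      ∑ r ∈ range (s + N - j + 1), 1 / (r.factorial : ℝ) * (t / Δ₂) ^ r))
      (kmuShadowedPDF γ κ (s + 1) (s + 1 + N) t) t := by
    intro t
    rw [hpdf]
    have h := HasDerivAt.fun_sum (u := range (N + 1)) fun j _ =>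
      ((hasDerivAt_exp_neg_mul_sum_pow_div_factorial (s + N - j) (t / Δ₂)).comp t
        ((hasDerivAt_id t).div_const Δ₂)).const_mul (B j)
    refine h.neg.congr_deriv ?_
    rw [← Finset.sum_neg_distrib]
    refine Finset.sum_congr rfl fun j _ => ?_
    ring
  have hcont : Continuous (kmuShadowedPDF γ κ (s + 1) (s + 1 + N)) := by
    rw [funext hpdf]
    fun_prop
  rw [intervalIntegral.integral_eq_sub_of_hasDerivAt (fun t _ => hderiv t)
    (hcont.intervalIntegrable 0 x)]
  have hzero : ∑ j ∈ range (N + 1), B j * (Real.exp (-(0 / Δ₂)) *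
      ∑ r ∈ range (s + N - j + 1), 1 / (r.factorial : ℝ) * (0 / Δ₂) ^ r) = 1 := by
    refine Eq.trans (Finset.sum_congr rfl fun j _ => ?_) hsumB
    simp [Finset.sum_range_succ']
  rw [hzero, neg_sub_neg]
  congr 1
  refine Finset.sum_congr rfl fun j hj => ?_
  have hj' : s + 1 + N - j = s + N - j + 1 := by
    have := Finset.mem_range.mp hj
    omega
  rw [hj', neg_div, mul_assoc]
end

section
/- Let γ̄ > 0, κ > 0 and let μ be a positive integer. For each positive integer m, let f_S(γ̄; κ, μ, m; ·) denote the κ-μ shadowed density, and let f_KM denote the κ-μ density with the same parameters γ̄, κ, μ. Then the sequence of CDFs converges pointwise: for every x ≥ 0, lim_{m→∞} ∫₀ˣ f_S(γ̄; κ, μ, m; t) dt = ∫₀ˣ f_KM(t) dt. -/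
open Real MeasureTheory Finset

/-- Modified Bessel function of the first kind of nonnegative integer order. -/
noncomputable def besselI (ν : ℕ) (z : ℝ) : ℝ :=
  ∑' k : ℕ, (z / 2) ^ (2 * k + ν) / ((Nat.factorial k : ℝ) * (Nat.factorial (k + ν) : ℝ))

/-- The κ-μ density with integer parameter μ. -/
noncomputable def kmuPDF (γ κ : ℝ) (μ : ℕ) (t : ℝ) : ℝ :=
  ((μ : ℝ) * (1 + κ) ^ (((μ : ℝ) + 1) / 2) /
      (γ * κ ^ (((μ : ℝ) - 1) / 2) * Real.exp (μ * κ))) *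
    (t / γ) ^ (((μ : ℝ) - 1) / 2) * Real.exp (-(μ * (1 + κ) * t / γ)) *
    besselI (μ - 1) (2 * μ * Real.sqrt (κ * (1 + κ) * t / γ))

open Filter Topology

theorem risingFactorial_div_pow (a c : ℝ) (n : ℕ) :
    risingFactorial a n / c ^ n = ∏ i ∈ Finset.range n, (a + i) / c := by
  rw [risingFactorial, Finset.prod_div_distrib, Finset.prod_const, Finset.card_range]

theorem risingFactorial_nonneg {a : ℝ} (ha : 0 ≤ a) (n : ℕ) : 0 ≤ risingFactorial a n :=
  Finset.prod_nonneg fun _ _ => by positivity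

theorem risingFactorial_natCast_succ (p n : ℕ) :
    risingFactorial ((p + 1 : ℕ) : ℝ) n * (Nat.factorial p : ℝ) = Nat.factorial (n + p) := by
  induction n with
  | zero => simp [risingFactorial]
  | succ n ih =>
    rw [risingFactorial, Finset.prod_range_succ, ← risingFactorial, mul_right_comm, ih,
      show n + 1 + p = (n + p) + 1 by ring, Nat.factorial_succ]
    push_cast
    ring

theorem factorial_le_risingFactorial {b : ℝ} (hb : 1 ≤ b) (n : ℕ) :
    (Nat.factorial n : ℝ) ≤ risingFactorial b n := by
  rw [← Finset.prod_range_add_one_eq_factorial, risingFactorial]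
  push_cast
  refine Finset.prod_le_prod (fun _ _ => by positivity) fun i _ => by linarith

theorem risingFactorial_div_pow_le_factorial {a c : ℝ} (ha : 1 ≤ a) (hc : a ≤ c) (n : ℕ) :
    risingFactorial a n / c ^ n ≤ Nat.factorial n := by
  rw [risingFactorial_div_pow, ← Finset.prod_range_add_one_eq_factorial]
  push_cast
  have ha0 : 0 ≤ a := by linarith
  have hc0 : 0 ≤ c := by linarith
  refine Finset.prod_le_prod (fun _ _ => by positivity) fun i _ => ?_
  rw [div_le_iff₀ (by linarith)]
  nlinarith [(Nat.cast_nonneg i : (0 : ℝ) ≤ i)]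

theorem abs_hyp1F1_term_le {a b c : ℝ} (ha : 1 ≤ a) (hb : 1 ≤ b) (hc : a ≤ c) (w : ℝ) (n : ℕ) :
    ‖risingFactorial a n / risingFactorial b n * (w / c) ^ n / (Nat.factorial n : ℝ)‖ ≤
      |w| ^ n / Nat.factorial n := by
  have hn : (0 : ℝ) < Nat.factorial n := by positivity
  have hc0 : 0 < c := by linarith
  have hb0 := factorial_le_risingFactorial hb n
  have hb1 : 0 < risingFactorial b n := hn.trans_le hb0
  have ha0 := risingFactorial_nonneg (zero_le_one.trans ha) n
  rw [show risingFactorial a n / risingFactorial b n * (w / c) ^ n / (Nat.factorial n : ℝ) =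
      risingFactorial a n / c ^ n / risingFactorial b n * (w ^ n / Nat.factorial n) by
        rw [div_pow]; ring, norm_mul, Real.norm_of_nonneg (by positivity), norm_div, norm_pow,
      Real.norm_eq_abs, Real.norm_of_nonneg hn.le]
  refine mul_le_of_le_one_left (by positivity) ?_
  exact div_le_one_of_le₀ ((risingFactorial_div_pow_le_factorial ha hc n).trans hb0) hb1.le

theorem abs_hyp1F1_le {a b c : ℝ} (ha : 1 ≤ a) (hb : 1 ≤ b) (hc : a ≤ c) (w : ℝ) :
    ‖hyp1F1 a b (w / c)‖ ≤ Real.exp |w| := by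
  have h : HasSum (fun n : ℕ => |w| ^ n / (Nat.factorial n : ℝ)) (Real.exp |w|) := by
    rw [Real.exp_eq_exp_ℝ]
    exact NormedSpace.expSeries_div_hasSum_exp |w|
  exact tsum_of_norm_bounded h (abs_hyp1F1_term_le ha hb hc w)

theorem measurable_hyp1F1 {a b : ℝ} (ha : 1 ≤ a) (hb : 1 ≤ b) : Measurable (hyp1F1 a b) := by
  have hs (z : ℝ) : Summable fun n : ℕ =>
      risingFactorial a n / risingFactorial b n * z ^ n / (Nat.factorial n : ℝ) := by
    refine Summable.of_norm_bounded (Real.summable_pow_div_factorial |z * a|) fun n => ?_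
    have h := abs_hyp1F1_term_le ha hb le_rfl (z * a) n
    rwa [mul_div_cancel_right₀ z (by positivity)] at h
  refine measurable_of_tendsto_metrizable (f := fun N z => ∑ n ∈ Finset.range N,
    risingFactorial a n / risingFactorial b n * z ^ n / (Nat.factorial n : ℝ)) (fun N => ?_) ?_
  · fun_prop
  · exact tendsto_pi_nhds.2 fun z => (hs z).hasSum.tendsto_sum_nat

theorem tendsto_risingFactorial_div_pow (d : ℝ) (n : ℕ) :
    Tendsto (fun m : ℕ => risingFactorial m n / (d + m) ^ n) atTop (𝓝 1) := by
  simp_rw [risingFactorial_div_pow]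
  rw [← Finset.prod_const_one (s := Finset.range n)]
  refine tendsto_finsetProd _ fun i _ => ?_
  simpa [add_comm] using tendsto_add_mul_div_add_mul_atTop_nhds (i : ℝ) d 1 (d := 1) one_ne_zero

/-- The confluent limit `₁F₁(m; b; w / m) → ₀F₁(; b; w)`, with the denominator shifted by `d`. -/
theorem tendsto_hyp1F1_div {b d : ℝ} (hb : 1 ≤ b) (hd : 0 ≤ d) (w : ℝ) :
    Tendsto (fun m : ℕ => hyp1F1 m b (w / (d + m))) atTop
      (𝓝 (∑' n : ℕ, w ^ n / (risingFactorial b n * Nat.factorial n))) := by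
  refine tendsto_tsum_of_dominated_convergence (Real.summable_pow_div_factorial |w|)
    (fun n => ?_) ?_
  · convert (tendsto_risingFactorial_div_pow d n).mul_const
      (w ^ n / (risingFactorial b n * Nat.factorial n)) using 2
    · rw [div_pow]
      ring
    · ring
  · filter_upwards [eventually_ge_atTop 1] with m hm n
    exact abs_hyp1F1_term_le (by exact_mod_cast hm) hb (by linarith) w n

theorem kmuShadowedPDF_eq (γ κ : ℝ) (μ m : ℕ) (t : ℝ) :
    kmuShadowedPDF γ κ μ m t =
      (μ : ℝ) ^ μ * (1 + κ) ^ μ / (Nat.factorial (μ - 1) * γ) *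
        ((m : ℝ) / (m + μ * κ)) ^ m * (t / γ) ^ (μ - 1) *
        Real.exp (-(μ * (1 + κ) * t / γ)) *
        hyp1F1 m μ ((μ : ℝ) ^ 2 * κ * (1 + κ) * t / γ / (μ * κ + m)) := by
  rw [kmuShadowedPDF, div_div _ γ, mul_comm γ, div_pow]
  ring

theorem tendsto_div_add_pow_exp (d : ℝ) :
    Tendsto (fun m : ℕ => ((m : ℝ) / (m + d)) ^ m) atTop (𝓝 (Real.exp (-d))) := by
  rw [Real.exp_neg]
  refine ((Real.tendsto_one_add_div_pow_exp d).inv₀ (Real.exp_ne_zero _)).congr' ?_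
  filter_upwards [eventually_ge_atTop 1] with m hm
  have : (m : ℝ) ≠ 0 := by positivity
  rw [← inv_pow, one_add_div this, inv_div]

theorem kmuPDF_eq {γ κ : ℝ} (hγ : 0 < γ) (hκ : 0 < κ) {μ : ℕ} (hμ : 0 < μ) {t : ℝ} (ht : 0 ≤ t) :
    kmuPDF γ κ μ t =
      (μ : ℝ) ^ μ * (1 + κ) ^ μ / (Nat.factorial (μ - 1) * γ) *
        Real.exp (-(μ * κ)) * (t / γ) ^ (μ - 1) * Real.exp (-(μ * (1 + κ) * t / γ)) *
        ∑' n : ℕ, ((μ : ℝ) ^ 2 * κ * (1 + κ) * t / γ) ^ n /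
          (risingFactorial μ n * Nat.factorial n) := by
  obtain ⟨p, rfl⟩ : ∃ p, μ = p + 1 := ⟨μ - 1, by omega⟩
  have hκ1 : 0 < 1 + κ := by linarith
  have hs : 0 ≤ t / γ := by positivity
  have half (y : ℝ) (hy : 0 ≤ y) : y ^ ((((p + 1 : ℕ) : ℝ) - 1) / 2) = √y ^ p := by
    rw [Real.sqrt_eq_rpow, ← Real.rpow_mul_natCast hy]
    congr 1
    push_cast
    ring
  have half' : (1 + κ) ^ ((((p + 1 : ℕ) : ℝ) + 1) / 2) = √(1 + κ) ^ (p + 2) := by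
    rw [Real.sqrt_eq_rpow, ← Real.rpow_mul_natCast hκ1.le]
    congr 1
    push_cast
    ring
  have bessel : besselI p (2 * (p + 1 : ℕ) * √(κ * (1 + κ) * t / γ)) =
      (((p + 1 : ℕ) : ℝ) * (√κ * √(1 + κ) * √(t / γ))) ^ p / Nat.factorial p *
      ∑' n : ℕ, (((p + 1 : ℕ) : ℝ) ^ 2 * κ * (1 + κ) * t / γ) ^ n /
          (risingFactorial ((p + 1 : ℕ) : ℝ) n * Nat.factorial n) := by
    rw [besselI, ← tsum_mul_left]
    congr 1
    ext n
    rw [mul_div_assoc (κ * (1 + κ)) t γ, Real.sqrt_mul (by positivity), Real.sqrt_mul hκ.le,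
      ← risingFactorial_natCast_succ, pow_add, pow_mul,
      show (2 * ((p + 1 : ℕ) : ℝ) * (√κ * √(1 + κ) * √(t / γ)) / 2) ^ 2 =
        ((p + 1 : ℕ) : ℝ) ^ 2 * √κ ^ 2 * √(1 + κ) ^ 2 * √(t / γ) ^ 2 by ring,
      Real.sq_sqrt hκ.le, Real.sq_sqrt hκ1.le, Real.sq_sqrt hs]
    ring
  have sq : √(1 + κ) ^ (p + 2) * √(1 + κ) ^ p = (1 + κ) ^ (p + 1) := by
    rw [← pow_add, show p + 2 + p = 2 * (p + 1) by ring, pow_mul, Real.sq_sqrt hκ1.le]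
  have sq' : √(t / γ) ^ p * √(t / γ) ^ p = (t / γ) ^ p := by
    rw [← mul_pow, Real.mul_self_sqrt hs]
  rw [kmuPDF, half _ hκ.le, half _ hs, half', Nat.add_sub_cancel, bessel, Real.exp_neg (_ * κ),
    ← sq, ← sq']
  have : √κ ≠ 0 := by positivity
  field_simp
  ring

theorem norm_kmuShadowedPDF_le {γ κ : ℝ} (hγ : 0 < γ) (hκ : 0 < κ) {μ m : ℕ} (hμ : 0 < μ)
    (hm : 0 < m) {t x : ℝ} (ht : 0 ≤ t) (htx : t ≤ x) :
    ‖kmuShadowedPDF γ κ μ m t‖ ≤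
      (μ : ℝ) ^ μ * (1 + κ) ^ μ / (Nat.factorial (μ - 1) * γ) * (x / γ) ^ (μ - 1) *
        Real.exp ((μ : ℝ) ^ 2 * κ * (1 + κ) * x / γ) := by
  have hw : 0 ≤ (μ : ℝ) ^ 2 * κ * (1 + κ) * t / γ := by positivity
  have hF : ‖hyp1F1 m μ ((μ : ℝ) ^ 2 * κ * (1 + κ) * t / γ / (μ * κ + m))‖ ≤
      Real.exp ((μ : ℝ) ^ 2 * κ * (1 + κ) * x / γ) := by
    refine (abs_hyp1F1_le (by exact_mod_cast hm) (by exact_mod_cast hμ)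
      (le_add_of_nonneg_left (by positivity)) _).trans ?_
    rw [abs_of_nonneg hw]
    gcongr
  have hpow : ((m : ℝ) / (m + μ * κ)) ^ m ≤ 1 :=
    pow_le_one₀ (by positivity)
      (div_le_one_of_le₀ (le_add_of_nonneg_right (by positivity)) (by positivity))
  have hexp : Real.exp (-(μ * (1 + κ) * t / γ)) ≤ 1 :=
    Real.exp_le_one_iff.2 (neg_nonpos.2 (by positivity))
  have hx : 0 ≤ x := ht.trans htx
  rw [kmuShadowedPDF_eq, norm_mul, Real.norm_of_nonneg (by positivity)]
  calc _ ≤ (μ : ℝ) ^ μ * (1 + κ) ^ μ / (Nat.factorial (μ - 1) * γ) * 1 * (x / γ) ^ (μ - 1) * 1 *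
        Real.exp ((μ : ℝ) ^ 2 * κ * (1 + κ) * x / γ) := by gcongr
    _ = _ := by ring

theorem measurable_kmuShadowedPDF (γ κ : ℝ) {μ m : ℕ} (hμ : 0 < μ) (hm : 0 < m) :
    Measurable (kmuShadowedPDF γ κ μ m) := by
  have h := measurable_hyp1F1 (a := m) (b := μ) (by exact_mod_cast hm) (by exact_mod_cast hμ)
  unfold kmuShadowedPDF
  fun_prop

theorem tendsto_kmuShadowedPDF {γ κ : ℝ} (hγ : 0 < γ) (hκ : 0 < κ) {μ : ℕ} (hμ : 0 < μ) {t : ℝ}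
    (ht : 0 ≤ t) :
    Tendsto (fun m => kmuShadowedPDF γ κ μ m t) atTop (𝓝 (kmuPDF γ κ μ t)) := by
  simp_rw [kmuShadowedPDF_eq, kmuPDF_eq hγ hκ hμ ht]
  exact ((((tendsto_div_add_pow_exp _).const_mul _).mul_const _).mul_const _).mul
    (tendsto_hyp1F1_div (by exact_mod_cast hμ) (by positivity) _)

theorem kmuShadowed_cdf_tendsto_kmu_cdf (γ κ : ℝ) (hγ : 0 < γ) (hκ : 0 < κ)
    (μ : ℕ) (hμ : 0 < μ) (x : ℝ) (hx : 0 ≤ x) :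
    Filter.Tendsto (fun m : ℕ => ∫ t in (0 : ℝ)..x, kmuShadowedPDF γ κ μ m t)
      Filter.atTop (nhds (∫ t in (0 : ℝ)..x, kmuPDF γ κ μ t)) := by
  refine intervalIntegral.tendsto_integral_filter_of_dominated_convergence
    (fun _ => (μ : ℝ) ^ μ * (1 + κ) ^ μ / (Nat.factorial (μ - 1) * γ) * (x / γ) ^ (μ - 1) *
        Real.exp ((μ : ℝ) ^ 2 * κ * (1 + κ) * x / γ)) ?_ ?_ intervalIntegrable_const ?_
  · filter_upwards [eventually_gt_atTop 0] with m hm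
    exact (measurable_kmuShadowedPDF γ κ hμ hm).aestronglyMeasurable
  · filter_upwards [eventually_gt_atTop 0] with m hm
    refine ae_of_all _ fun t ht => ?_
    rw [Set.uIoc_of_le hx] at ht
    exact norm_kmuShadowedPDF_le hγ hκ hμ hm ht.1.le ht.2
  · refine ae_of_all _ fun t ht => ?_
    rw [Set.uIoc_of_le hx] at ht
    exact tendsto_kmuShadowedPDF hγ hκ hμ ht.1.le
end

section
/- Let γ̄ > 0, κ > 0 and let μ, m be positive integers with m < μ. Set Δ₁ = γ̄/(μ(1+κ)) and Δ₂ = ((μκ+m)/m)·γ̄/(μ(1+κ)), and let A₁ⱼ = (−1)^m · C(m+j−2, j−1) · (m/(μκ+m))^m · (μκ/(μκ+m))^{−(m+j−1)} and A₂ⱼ = (−1)^{j−1} · C(μ−m+j−2, j−1) · (m/(μκ+m))^{j−1} · (μκ/(μκ+m))^{m−μ−j+1}. Let 0 ≤ a < b ≤ ∞ and let h : ℝ → ℝ be such that x ↦ h(x)·f_S(x) is integrable on (a, b) and x ↦ h(x)·x^{k} e^{−x/Δᵢ} is integrable on (a, b) for the relevant exponents. Then ∫ₐᵇ h(x) f_S(x)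 dx = Σ_{j=1}^{μ−m} A₁ⱼ · ∫ₐᵇ h(x) · x^{μ−m−j} e^{−x/Δ₁} / ((μ−m−j)! Δ₁^{μ−m−j+1}) dx + Σ_{j=1}^{m} A₂ⱼ · ∫ₐᵇ h(x) · x^{m−j} e^{−x/Δ₂} / ((m−j)! Δ₂^{m−j+1}) dx. -/
open Real MeasureTheory Finset

theorem hasSum_of_eq {f g : ℕ → ℝ} {r s : ℝ} (h : HasSum f r) (hfg : ∀ k, g k = f k)
    (hrs : s = r) : HasSum g s := by
  rwa [funext hfg, hrs]

theorem sum_Icc_one_eq_sum_range (n : ℕ) (f : ℕ → ℝ) :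
    ∑ j ∈ Finset.Icc 1 n, f j = ∑ i ∈ Finset.range n, f (i + 1) := by
  induction n with
  | zero => simp
  | succ n ih => rw [Finset.sum_Icc_succ_top (by omega), ih, Finset.sum_range_succ]

theorem risingFactorial_succ_mul_factorial (b k : ℕ) :
    risingFactorial ((b + 1 : ℕ) : ℝ) k * (Nat.factorial b : ℝ) = (Nat.factorial (b + k) : ℝ) := by
  induction k with
  | zero => simp [risingFactorial]
  | succ k ih =>
    rw [risingFactorial, Finset.prod_range_succ, ← risingFactorial, mul_right_comm, ih,
      ← add_assoc, Nat.factorial_succ]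
    push_cast
    ring

theorem risingFactorial_eq_multichoose (m k : ℕ) :
    risingFactorial ((m + 1 : ℕ) : ℝ) k = (Nat.multichoose (m + 1) k : ℝ) * Nat.factorial k := by
  have hm : (Nat.factorial m : ℝ) ≠ 0 := by positivity
  apply mul_right_cancel₀ hm
  rw [risingFactorial_succ_mul_factorial, Nat.multichoose_eq,
    show m + 1 + k - 1 = m + k by omega, ← Nat.add_choose_mul_factorial_mul_factorial m k]
  push_cast
  ring

/-- The partial fraction expansion, in inverse Laplace form, of a confluent hypergeometric series
with positive integer parameters `m < m + n`, including the degenerate cases `m = 0`, `n = 0`. -/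
theorem hasSum_multichoose_mul_pow (q t : ℝ) (hq : q ≠ 0) (m n : ℕ) (hmn : 0 < m + n) :
    HasSum (fun k : ℕ => (Nat.multichoose m k : ℝ) * q ^ k *
        (t ^ (k + (m + n - 1)) / (Nat.factorial (k + (m + n - 1)) : ℝ)))
      ((∑ i ∈ Finset.range n, (-1 : ℝ) ^ m * (Nat.multichoose m i : ℝ) / q ^ (m + i) *
          (t ^ (n - 1 - i) / (Nat.factorial (n - 1 - i) : ℝ))) +
        Real.exp (q * t) * ∑ i ∈ Finset.range m,
          (-1 : ℝ) ^ i * (Nat.multichoose n i : ℝ) / q ^ (n + i) *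
          (t ^ (m - 1 - i) / (Nat.factorial (m - 1 - i) : ℝ))) := by
  induction m generalizing n with
  | zero =>
    obtain ⟨n, rfl⟩ : ∃ l, n = l + 1 := ⟨n - 1, by omega⟩
    rw [Finset.sum_range_succ']
    simp only [Nat.multichoose_zero_succ]
    convert hasSum_single (f := fun k : ℕ => (Nat.multichoose 0 k : ℝ) * q ^ k *
        (t ^ (k + (0 + (n + 1) - 1)) / (Nat.factorial (k + (0 + (n + 1) - 1)) : ℝ))) 0 ?_ using 1
    · simp
    · rintro (_ | k) hk
      · exact absurd rfl hk
      · simp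
  | succ m ihm =>
    induction n with
    | zero =>
      rw [Finset.sum_range_succ']
      simp only [Nat.multichoose_zero_succ]
      have h := (NormedSpace.expSeries_div_hasSum_exp (q * t)).mul_right
        (t ^ m / (Nat.factorial m : ℝ))
      rw [← Real.exp_eq_exp_ℝ] at h
      refine hasSum_of_eq h (fun k => ?_) ?_
      · have key := Nat.add_choose_mul_factorial_mul_factorial m k
        rw [Nat.multichoose_eq, show m + 1 + k - 1 = m + k by omega,
          show k + (m + 1 + 0 - 1) = m + k by omega, ← key]
        have hc : ((m + k).choose k : ℝ) ≠ 0 := by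
          exact_mod_cast (Nat.choose_pos (by omega)).ne'
        push_cast
        field_simp
        ring
      · simp
    | succ n ihn =>
      have h₁ := ihn (by omega)
      have h₂ := ihm (n + 1) (by omega)
      have h := h₁.sub h₂
      rw [← hasSum_nat_add_iff' 1] at h
      replace h := h.mul_left q⁻¹
      refine hasSum_of_eq h (fun k => ?_) ?_
      · rw [show k + (m + 1 + (n + 1) - 1) = k + m + n + 1 by omega,
          show k + 1 + (m + 1 + n - 1) = k + m + n + 1 by omega,
          show k + 1 + (m + (n + 1) - 1) = k + m + n + 1 by omega,
          Nat.multichoose_succ_succ]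
        push_cast
        field_simp
        ring
      · have e₁ : ∀ i, n + 1 - 1 - (i + 1) = n - 1 - i := by omega
        have e₂ : ∀ i, m + 1 - 1 - (i + 1) = m - 1 - i := by omega
        rw [Finset.sum_range_one]
        simp only [Nat.multichoose_zero_right, zero_add, pow_zero,
          show m + 1 + n - 1 = m + (n + 1) - 1 by omega, sub_self, sub_zero]
        rw [eq_inv_mul_iff_mul_eq₀ hq]
        have hl : q * ∑ i ∈ Finset.range (n + 1),
            (-1 : ℝ) ^ (m + 1) * (Nat.multichoose (m + 1) i : ℝ) / q ^ (m + 1 + i) *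
              (t ^ (n + 1 - 1 - i) / (Nat.factorial (n + 1 - 1 - i) : ℝ)) =
            ∑ i ∈ Finset.range n,
              (-1 : ℝ) ^ (m + 1) * (Nat.multichoose (m + 1) i : ℝ) / q ^ (m + 1 + i) *
                (t ^ (n - 1 - i) / (Nat.factorial (n - 1 - i) : ℝ)) -
            ∑ i ∈ Finset.range (n + 1),
              (-1 : ℝ) ^ m * (Nat.multichoose m i : ℝ) / q ^ (m + i) *
                (t ^ (n + 1 - 1 - i) / (Nat.factorial (n + 1 - 1 - i) : ℝ)) := by
          rw [Finset.sum_range_succ' _ n, Finset.sum_range_succ' _ n, mul_add, Finset.mul_sum,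
            ← sub_sub, ← Finset.sum_sub_distrib, sub_eq_add_neg]
          congr 1
          · refine Finset.sum_congr rfl fun i _ => ?_
            rw [e₁, Nat.multichoose_succ_succ]
            push_cast
            field_simp
            ring
          · simp only [Nat.multichoose_zero_right]
            field_simp
            ring
        have hr : q * ∑ i ∈ Finset.range (m + 1),
            (-1 : ℝ) ^ i * (Nat.multichoose (n + 1) i : ℝ) / q ^ (n + 1 + i) *
              (t ^ (m + 1 - 1 - i) / (Nat.factorial (m + 1 - 1 - i) : ℝ)) =
            ∑ i ∈ Finset.range (m + 1),
              (-1 : ℝ) ^ i * (Nat.multichoose n i : ℝ) / q ^ (n + i) *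
                (t ^ (m + 1 - 1 - i) / (Nat.factorial (m + 1 - 1 - i) : ℝ)) -
            ∑ i ∈ Finset.range m,
              (-1 : ℝ) ^ i * (Nat.multichoose (n + 1) i : ℝ) / q ^ (n + 1 + i) *
                (t ^ (m - 1 - i) / (Nat.factorial (m - 1 - i) : ℝ)) := by
          rw [Finset.sum_range_succ' _ m, Finset.sum_range_succ' _ m, mul_add, Finset.mul_sum,
            add_sub_right_comm, ← Finset.sum_sub_distrib]
          congr 1
          · refine Finset.sum_congr rfl fun i _ => ?_
            rw [e₂, Nat.multichoose_succ_succ]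
            push_cast
            field_simp
            ring
          · simp only [Nat.multichoose_zero_right]
            field_simp
            ring
        rw [mul_add, mul_left_comm, hl, hr]
        ring

/-- `t ^ (m + n) / (m + n)! · ₁F₁(m + 1; m + n + 1; q t)` as a finite sum. -/
theorem pow_div_factorial_mul_hyp1F1 (q t : ℝ) (hq : q ≠ 0) (m n : ℕ) :
    t ^ (m + n) / (Nat.factorial (m + n) : ℝ) *
        hyp1F1 ((m + 1 : ℕ) : ℝ) ((m + n + 1 : ℕ) : ℝ) (q * t) =
      (∑ i ∈ Finset.range n, (-1 : ℝ) ^ (m + 1) * (Nat.multichoose (m + 1) i : ℝ) /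
          q ^ (m + 1 + i) * (t ^ (n - 1 - i) / (Nat.factorial (n - 1 - i) : ℝ))) +
        Real.exp (q * t) * ∑ i ∈ Finset.range (m + 1),
          (-1 : ℝ) ^ i * (Nat.multichoose n i : ℝ) / q ^ (n + i) *
          (t ^ (m - i) / (Nat.factorial (m - i) : ℝ)) := by
  rw [hyp1F1, ← tsum_mul_left]
  refine Eq.trans ?_ (hasSum_multichoose_mul_pow q t hq (m + 1) n (by omega)).tsum_eq
  refine tsum_congr fun k => ?_
  have hr : risingFactorial ((m + n + 1 : ℕ) : ℝ) k =
      (Nat.factorial (m + n + k) : ℝ) / (Nat.factorial (m + n) : ℝ) := by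
    rw [eq_div_iff (by positivity), risingFactorial_succ_mul_factorial]
  rw [hr, risingFactorial_eq_multichoose, show k + (m + 1 + n - 1) = m + n + k by omega]
  field_simp
  ring

theorem kmuShadowedPDF_eq_sum_s13 (γ κ : ℝ) (hγ : 0 < γ) (hκ : 0 < κ)
    (μ m : ℕ) (hm : 0 < m) (hmμ : m < μ) (Δ₁ Δ₂ : ℝ)
    (hΔ₁ : Δ₁ = γ / (μ * (1 + κ)))
    (hΔ₂ : Δ₂ = ((μ * κ + m) / m) * (γ / (μ * (1 + κ))))
    (A₁ A₂ : ℕ → ℝ)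
    (hA₁ : ∀ j, A₁ j = (-1 : ℝ) ^ m * (Nat.choose (m + j - 2) (j - 1) : ℝ) *
      ((m : ℝ) / (μ * κ + m)) ^ m *
      ((μ : ℝ) * κ / (μ * κ + m)) ^ (-((m : ℤ) + j - 1)))
    (hA₂ : ∀ j, A₂ j = (-1 : ℝ) ^ (j - 1) * (Nat.choose (μ - m + j - 2) (j - 1) : ℝ) *
      ((m : ℝ) / (μ * κ + m)) ^ (j - 1) *
      ((μ : ℝ) * κ / (μ * κ + m)) ^ ((m : ℤ) - μ - j + 1))
    (x : ℝ) :
    kmuShadowedPDF γ κ μ m x =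
      (∑ j ∈ Finset.Icc 1 (μ - m), A₁ j * (x ^ (μ - m - j) * Real.exp (-x / Δ₁) /
          ((Nat.factorial (μ - m - j) : ℝ) * Δ₁ ^ (μ - m - j + 1)))) +
      (∑ j ∈ Finset.Icc 1 m, A₂ j * (x ^ (m - j) * Real.exp (-x / Δ₂) /
          ((Nat.factorial (m - j) : ℝ) * Δ₂ ^ (m - j + 1)))) := by
  obtain ⟨m, rfl⟩ : ∃ l, m = l + 1 := ⟨m - 1, by omega⟩
  obtain ⟨n, rfl⟩ : ∃ l, μ = m + l + 1 := ⟨μ - m - 1, by omega⟩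
  have hn : m + n + 1 - (m + 1) = n := by omega
  have hM : (0 : ℝ) < ((m + 1 : ℕ) : ℝ) := by positivity
  have hU : (0 : ℝ) < ((m + n + 1 : ℕ) : ℝ) := by positivity
  generalize hMd : ((m + 1 : ℕ) : ℝ) = M at *
  generalize hUd : ((m + n + 1 : ℕ) : ℝ) = U at *
  have hD : 0 < U * κ + M := by positivity
  have hκ₁ : 0 < 1 + κ := by positivity
  obtain ⟨p, hp⟩ : ∃ p, p = M / (U * κ + M) := ⟨_, rfl⟩
  obtain ⟨q, hq⟩ : ∃ q, q = U * κ / (U * κ + M) := ⟨_, rfl⟩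
  have hp₀ : 0 < p := by rw [hp]; positivity
  have hq₀ : 0 < q := by rw [hq]; positivity
  have hpq : p + q = 1 := by rw [hp, hq]; field_simp; ring
  have hΔ₀ : 0 < Δ₁ := by rw [hΔ₁]; positivity
  have hΔ₂' : Δ₂ = Δ₁ / p := by rw [hΔ₂, hΔ₁, hp]; field_simp
  rw [← hp, ← hq] at hA₁ hA₂
  obtain ⟨t, ht⟩ : ∃ t, t = x / Δ₁ := ⟨_, rfl⟩
  have hx : x = t * Δ₁ := by rw [ht]; field_simp
  have hz : U ^ 2 * κ * (1 + κ) * x / ((U * κ + M) * γ) = q * t := by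
    rw [ht, hq, hΔ₁]; field_simp
  have hpre : U ^ (m + n + 1) * M ^ (m + 1) * (1 + κ) ^ (m + n + 1) /
      ((Nat.factorial (m + n) : ℝ) * (M + U * κ) ^ (m + 1) * γ) * (x / γ) ^ (m + n) =
      p ^ (m + 1) / Δ₁ * (t ^ (m + n) / (Nat.factorial (m + n) : ℝ)) := by
    rw [ht, hp, hΔ₁, add_comm M]
    simp only [div_pow, mul_pow]
    field_simp
    ring
  have he : Real.exp (-(U * (1 + κ) * x / γ)) = Real.exp (-t) := by
    rw [ht, hΔ₁]; congr 1; field_simp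
  have he₁ : -x / Δ₁ = -t := by rw [ht]; ring
  have he₂ : -x / Δ₂ = -t + q * t := by
    rw [hΔ₂', hx, eq_sub_of_add_eq hpq]; field_simp; ring
  rw [kmuShadowedPDF, hUd, hMd, hz, he, Nat.add_sub_cancel, hpre, he₁, he₂, Real.exp_add,
    hn, sum_Icc_one_eq_sum_range, sum_Icc_one_eq_sum_range]
  have key := pow_div_factorial_mul_hyp1F1 q t hq₀.ne' m n
  rw [hMd, hUd] at key
  rw [show ∀ a b c d : ℝ, a * b * c * d = a * c * (b * d) by intros; ring, key, mul_add,
    mul_left_comm _ (Real.exp (q * t)), Finset.mul_sum, Finset.mul_sum, Finset.mul_sum]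
  congr 1
  · refine Finset.sum_congr rfl fun i _ => ?_
    rw [hA₁, Nat.multichoose_eq, show m + 1 + (i + 1) - 2 = m + 1 + i - 1 by omega,
      Nat.add_sub_cancel, show n - (i + 1) = n - 1 - i by omega,
      show -(((m + 1 : ℕ) : ℤ) + ((i + 1 : ℕ) : ℤ) - 1) = -((m + 1 + i : ℕ) : ℤ) by
        push_cast; ring,
      zpow_neg, zpow_natCast, hx, mul_pow]
    field_simp
    ring
  · refine Finset.sum_congr rfl fun i hi => ?_
    obtain ⟨l, rfl⟩ := Nat.exists_eq_add_of_le (Nat.lt_succ_iff.mp (Finset.mem_range.mp hi))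
    rw [hA₂, hn, Nat.multichoose_eq, show n + (i + 1) - 2 = n + i - 1 by omega,
      Nat.add_sub_cancel, show i + l + 1 - (i + 1) = l by omega, Nat.add_sub_cancel_left,
      show ((i + l + 1 : ℕ) : ℤ) - ((i + l + n + 1 : ℕ) : ℤ) - ((i + 1 : ℕ) : ℤ) + 1 =
        -((n + i : ℕ) : ℤ) by push_cast; ring,
      zpow_neg, zpow_natCast, hx, hΔ₂', mul_pow, div_pow]
    field_simp
    ring

theorem kmuShadowed_average_metric_of_lt (γ κ : ℝ) (hγ : 0 < γ) (hκ : 0 < κ)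
    (μ m : ℕ) (hμ : 0 < μ) (hm : 0 < m) (hmμ : m < μ) (Δ₁ Δ₂ : ℝ)
    (hΔ₁ : Δ₁ = γ / (μ * (1 + κ)))
    (hΔ₂ : Δ₂ = ((μ * κ + m) / m) * (γ / (μ * (1 + κ))))
    (A₁ A₂ : ℕ → ℝ)
    (hA₁ : ∀ j, A₁ j = (-1 : ℝ) ^ m * (Nat.choose (m + j - 2) (j - 1) : ℝ) *
      ((m : ℝ) / (μ * κ + m)) ^ m *
      ((μ : ℝ) * κ / (μ * κ + m)) ^ (-((m : ℤ) + j - 1)))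
    (hA₂ : ∀ j, A₂ j = (-1 : ℝ) ^ (j - 1) * (Nat.choose (μ - m + j - 2) (j - 1) : ℝ) *
      ((m : ℝ) / (μ * κ + m)) ^ (j - 1) *
      ((μ : ℝ) * κ / (μ * κ + m)) ^ ((m : ℤ) - μ - j + 1))
    (a : ℝ) (b : EReal) (ha : 0 ≤ a) (hab : (a : EReal) < b)
    (S : Set ℝ) (hS : S = {x : ℝ | a < x ∧ (x : EReal) < b})
    (h : ℝ → ℝ)
    (hint : MeasureTheory.IntegrableOn (fun x => h x * kmuShadowedPDF γ κ μ m x) S)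
    (hint₁ : ∀ j ∈ Finset.Icc 1 (μ - m),
      MeasureTheory.IntegrableOn (fun x => h x * (x ^ (μ - m - j) * Real.exp (-x / Δ₁))) S)
    (hint₂ : ∀ j ∈ Finset.Icc 1 m,
      MeasureTheory.IntegrableOn (fun x => h x * (x ^ (m - j) * Real.exp (-x / Δ₂))) S) :
    ∫ x in S, h x * kmuShadowedPDF γ κ μ m x =
      (∑ j ∈ Finset.Icc 1 (μ - m),
        A₁ j * ∫ x in S, h x * (x ^ (μ - m - j) * Real.exp (-x / Δ₁) /
          ((Nat.factorial (μ - m - j) : ℝ) * Δ₁ ^ (μ - m - j + 1)))) +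
      (∑ j ∈ Finset.Icc 1 m,
        A₂ j * ∫ x in S, h x * (x ^ (m - j) * Real.exp (-x / Δ₂) /
          ((Nat.factorial (m - j) : ℝ) * Δ₂ ^ (m - j + 1)))) := by
  have hpdf := kmuShadowedPDF_eq_sum_s13 γ κ hγ hκ μ m hm hmμ Δ₁ Δ₂ hΔ₁ hΔ₂ A₁ A₂ hA₁ hA₂
  have hi₁ : ∀ j ∈ Finset.Icc 1 (μ - m), IntegrableOn (fun x => A₁ j *
      (h x * (x ^ (μ - m - j) * Real.exp (-x / Δ₁) /
        ((Nat.factorial (μ - m - j) : ℝ) * Δ₁ ^ (μ - m - j + 1))))) S := by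
    intro j hj
    refine Integrable.const_mul ?_ _
    simpa only [mul_div_assoc'] using (hint₁ j hj).div_const
      ((Nat.factorial (μ - m - j) : ℝ) * Δ₁ ^ (μ - m - j + 1))
  have hi₂ : ∀ j ∈ Finset.Icc 1 m, IntegrableOn (fun x => A₂ j *
      (h x * (x ^ (m - j) * Real.exp (-x / Δ₂) /
        ((Nat.factorial (m - j) : ℝ) * Δ₂ ^ (m - j + 1))))) S := by
    intro j hj
    refine Integrable.const_mul ?_ _
    simpa only [mul_div_assoc'] using (hint₂ j hj).div_const
      ((Nat.factorial (m - j) : ℝ) * Δ₂ ^ (m - j + 1))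
  simp only [← integral_const_mul]
  rw [← integral_finsetSum _ hi₁, ← integral_finsetSum _ hi₂,
    ← integral_add (integrable_finsetSum _ hi₁) (integrable_finsetSum _ hi₂)]
  congr 1
  funext x
  rw [hpdf x, mul_add, Finset.mul_sum, Finset.mul_sum]
  congr 1 <;> exact Finset.sum_congr rfl fun j _ => mul_left_comm _ _ _
end
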